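/- arXiv:1501.07059 — 2 statements merged into one kernel-verified Lean document; each statement's English description precedes it below -/
import Mathlib

section
/- Let B ⊂ ℝ³ be the open unit ball, let q ≥ 1 and let λ ∈ [2q+2, 4q+1]. Then there exists a constant C > 0 such that for every function φ : ℝ³ → ℝ that is twice continuously differentiable on the closed unit ball and satisfies the boundary condition φ(x) · ⟨∇φ(x), x⟩ = 0 for every x with |x| = 1, one has (∫_B |∇φ|^λ)^{1/λ} ≤ C · (∫_B |∇φ|^{2q−2} |D²φ|²)^{(λ−3)/((2q−1)λ)} · (sup_{B} |φ|)^{(6q−λ)/((2q−1)λ)} + C · sup_{B} |φ|, where D²φ denotes the Hessian matrix of φ and |D²φ| its Frobenius norm. -/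
open MeasureTheory

/-- The closed unit ball in `ℝ³`. -/
def cball3 : Set (EuclideanSpace ℝ (Fin 3)) := Metric.closedBall 0 1

/-- The open unit ball in `ℝ³`. -/
def ball3 : Set (EuclideanSpace ℝ (Fin 3)) := Metric.ball 0 1

/-- The gradient of `φ` (as a continuous linear functional), taken within the closed unit ball. -/
noncomputable def grad3 (φ : EuclideanSpace ℝ (Fin 3) → ℝ) (x : EuclideanSpace ℝ (Fin 3)) :
    EuclideanSpace ℝ (Fin 3) →L[ℝ] ℝ :=
  fderivWithin ℝ φ cball3 x

/-- The `(i,j)` entry of the Hessian matrix `D²φ` at `x`, taken within the closed unit ball. -/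
noncomputable def hess3 (φ : EuclideanSpace ℝ (Fin 3) → ℝ) (x : EuclideanSpace ℝ (Fin 3))
    (i j : Fin 3) : ℝ :=
  fderivWithin ℝ (fun y => grad3 φ y (EuclideanSpace.single j 1)) cball3 x
    (EuclideanSpace.single i 1)

/-- The square of the Frobenius norm `|D²φ|²` of the Hessian of `φ` at `x`. -/
noncomputable def hessFrobSq (φ : EuclideanSpace ℝ (Fin 3) → ℝ)
    (x : EuclideanSpace ℝ (Fin 3)) : ℝ :=
  ∑ i, ∑ j, (hess3 φ x i j) ^ 2


abbrev E3 := EuclideanSpace ℝ (Fin 3)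

/-- Segment hypothesis for the Sobolev inequality. -/
def SegHyp (f H : E3 → ENNReal) : Prop :=
  ∀ x v : E3, ‖v‖ = 1 → (∀ t ∈ Set.Icc (0 : ℝ) (1/4), x + t • v ∈ ball3) →
    f x ≤ ∫⁻ t in Set.Icc (0 : ℝ) (1/4), H (x + t • v)

theorem update_eq_add (x : Fin 3 → ℝ) (i : Fin 3) (s : ℝ) :
    WithLp.toLp 2 (Function.update x i (x i - s)) =
      (WithLp.toLp 2 x : E3) + s • (-(EuclideanSpace.single i (1 : ℝ))) := by
  ext j
  by_cases h : j = i
  · subst h; simp [sub_eq_add_neg]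
  · simp [h]

theorem sob_local (f H : E3 → ENNReal) (hH : Measurable (ball3.indicator H)) (hfH : SegHyp f H)
    (T : Set E3) (hTm : MeasurableSet T)
    (hT : ∀ x ∈ T, ∀ i : Fin 3, ∀ t ∈ Set.Icc (0 : ℝ) (1/4),
      x + t • (-(EuclideanSpace.single i (1 : ℝ))) ∈ ball3) :
    ∫⁻ x in T, f x ^ (3/2 : ℝ) ≤ (∫⁻ x in ball3, H x) ^ (3/2 : ℝ) := by
  have hb : MeasurableSet ball3 := Metric.isOpen_ball.measurableSet
  set K : E3 → ENNReal := ball3.indicator H with hK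
  have key : ∀ x ∈ T, ∀ i : Fin 3, f x ≤ ∫⁻ s : ℝ, K (WithLp.toLp 2 (Function.update x.ofLp i s)) := by
    intro x hx i
    have h1 := hfH x (-(EuclideanSpace.single i (1 : ℝ))) (by simp) (hT x hx i)
    refine h1.trans ?_
    rw [← lintegral_sub_left_eq_self (μ := (volume : Measure ℝ)) (fun s => K (WithLp.toLp 2 (Function.update x.ofLp i s))) (x i)]
    calc _ = ∫⁻ t in Set.Icc (0 : ℝ) (1/4), K (WithLp.toLp 2 (Function.update x.ofLp i (x i - t))) := by
          apply setLIntegral_congr_fun measurableSet_Icc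
          intro t ht
          have := update_eq_add x.ofLp i t
          simp only
          rw [this]
          simp only [hK]
          rw [Set.indicator_of_mem]
          exact hT x hx i t ht
      _ ≤ _ := setLIntegral_le_lintegral _ _
  have hconj : Real.HolderConjugate (Fintype.card (Fin 3)) (3/2 : ℝ) := by
    rw [Real.holderConjugate_iff]; norm_num
  have hKm : Measurable (fun y : Fin 3 → ℝ => K (WithLp.toLp 2 y)) :=
    hH.comp (MeasurableEquiv.toLp 2 (Fin 3 → ℝ)).measurable
  have LW := lintegral_prod_lintegral_pow_le (fun _ : Fin 3 => (volume : Measure ℝ)) hconj hKm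
  have e1 : ∫⁻ x in ball3, H x = ∫⁻ y : Fin 3 → ℝ, K (WithLp.toLp 2 y) := by
    rw [← lintegral_indicator hb]
    exact ((PiLp.volume_preserving_toLp (Fin 3)).lintegral_comp hH).symm
  rw [e1]
  refine le_trans ?_ LW
  rw [← lintegral_indicator hTm]
  have e2 : ∀ G : E3 → ENNReal, ∫⁻ x, G x = ∫⁻ y : Fin 3 → ℝ, G (WithLp.toLp 2 y) := fun G =>
    ((PiLp.volume_preserving_toLp (Fin 3)).lintegral_comp_emb
      (MeasurableEquiv.toLp 2 (Fin 3 → ℝ)).measurableEmbedding G).symm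
  rw [e2, ← volume_pi]
  apply lintegral_mono
  intro y
  by_cases hy : (WithLp.toLp 2 y : E3) ∈ T
  · simp only [Set.indicator_of_mem hy]
    have : f (WithLp.toLp 2 y) ^ (3/2 : ℝ) =
        ∏ i : Fin 3, f (WithLp.toLp 2 y) ^ ((1 : ℝ) / ((Fintype.card (Fin 3) : ℝ) - 1)) := by
      simp only [Finset.prod_const, Finset.card_univ, Fintype.card_fin]
      rw [← ENNReal.rpow_natCast, ← ENNReal.rpow_mul]
      norm_num
    rw [this]
    apply Finset.prod_le_prod'
    intro i _
    apply ENNReal.rpow_le_rpow _ (by norm_num)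
    exact key _ hy i
  · simp [Set.indicator_of_notMem hy]

theorem segHyp_comp (f H : E3 → ENNReal) (hfH : SegHyp f H) (R : E3 ≃ₗᵢ[ℝ] E3) :
    SegHyp (f ∘ R) (H ∘ R) := by
  intro x v hv hx
  have := hfH (R x) (R v) (by simpa using hv) (fun t ht => by
    have := hx t ht
    simp only [ball3, mem_ball_zero_iff] at this ⊢
    rw [← map_smul, ← map_add, R.norm_map]; exact this)
  simpa using this

theorem ball3_preimage (R : E3 ≃ₗᵢ[ℝ] E3) : R ⁻¹' ball3 = ball3 := by
  ext x; simp [ball3]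

theorem sob_local_rot (R : E3 ≃ₗᵢ[ℝ] E3) (f H : E3 → ENNReal) (hH : Measurable (ball3.indicator H))
    (hfH : SegHyp f H)
    (T : Set E3) (hTm : MeasurableSet T)
    (hT : ∀ x ∈ T, ∀ i : Fin 3, ∀ t ∈ Set.Icc (0 : ℝ) (1/4),
      x + t • (-(EuclideanSpace.single i (1 : ℝ))) ∈ ball3) :
    ∫⁻ x in R.symm ⁻¹' T, f x ^ (3/2 : ℝ) ≤ (∫⁻ x in ball3, H x) ^ (3/2 : ℝ) := by
  have hmp := R.measurePreserving
  have hme : MeasurableEmbedding R := R.toHomeomorph.measurableEmbedding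
  have h1 : ∫⁻ x in R.symm ⁻¹' T, f x ^ (3/2 : ℝ) = ∫⁻ x in T, (f ∘ R) x ^ (3/2 : ℝ) := by
    have := hmp.setLIntegral_comp_preimage_emb hme (fun x => f x ^ (3/2 : ℝ)) (R.symm ⁻¹' T)
    rw [← this]
    congr 2
    ext x; simp
  have h2 : ∫⁻ x in ball3, H x = ∫⁻ x in ball3, (H ∘ R) x := by
    have := hmp.setLIntegral_comp_preimage_emb hme H ball3
    rw [← this, ball3_preimage]; rfl
  rw [h1, h2]
  apply sob_local _ _ _ (segHyp_comp f H hfH R) T hTm hT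
  have : ball3.indicator (H ∘ R) = (ball3.indicator H) ∘ R := by
    conv_lhs => rw [← ball3_preimage R]
    rfl
  rw [this]
  exact hH.comp R.continuous.measurable

theorem sobolev : ∃ C : NNReal, ∀ f H : E3 → ENNReal, Measurable (ball3.indicator H) → SegHyp f H →
    ∫⁻ x in ball3, f x ^ (3/2 : ℝ) ≤ C * (∫⁻ x in ball3, H x) ^ (3/2 : ℝ) := by
  have hb : MeasurableSet ball3 := Metric.isOpen_ball.measurableSet
  have hc : IsCompact cball3 := isCompact_closedBall 0 1
  suffices h : ∃ C : NNReal, ∀ f H : E3 → ENNReal, Measurable (ball3.indicator H) → SegHyp f H →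
      ∫⁻ x in cball3 ∩ ball3, f x ^ (3/2 : ℝ) ≤ C * (∫⁻ x in ball3, H x) ^ (3/2 : ℝ) by
    have hi : cball3 ∩ ball3 = ball3 := Set.inter_eq_right.2 Metric.ball_subset_closedBall
    rwa [hi] at h
  refine hc.induction_on (p := fun S => ∃ C : NNReal, ∀ f H : E3 → ENNReal,
    Measurable (ball3.indicator H) → SegHyp f H →
      ∫⁻ x in S ∩ ball3, f x ^ (3/2 : ℝ) ≤ C * (∫⁻ x in ball3, H x) ^ (3/2 : ℝ)) ?_ ?_ ?_ ?_
  · exact ⟨0, by simp⟩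
  · rintro s t hst ⟨C, hC⟩
    exact ⟨C, fun f H h1 h2 => (lintegral_mono_set (Set.inter_subset_inter_left _ hst)).trans
      (hC f H h1 h2)⟩
  · rintro s t ⟨C, hC⟩ ⟨D, hD⟩
    refine ⟨C + D, fun f H h1 h2 => ?_⟩
    rw [Set.union_inter_distrib_right, ENNReal.coe_add, add_mul]
    exact (lintegral_union_le _ _ _).trans (add_le_add (hC f H h1 h2) (hD f H h1 h2))
  · intro p hp
    by_cases hp2 : ‖p‖ < 1/2
    · refine ⟨Metric.ball 0 (1/2), mem_nhdsWithin_of_mem_nhds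
        (Metric.isOpen_ball.mem_nhds (by simpa using hp2)), 1, fun f H h1 h2 => ?_⟩
      rw [ENNReal.coe_one, one_mul]
      refine sob_local f H h1 h2 _ (Metric.isOpen_ball.measurableSet.inter hb) ?_
      rintro x ⟨hx, -⟩ i t ht
      simp only [mem_ball_zero_iff, ball3] at hx ⊢
      calc _ ≤ ‖x‖ + ‖t • (-(EuclideanSpace.single i (1 : ℝ)))‖ := norm_add_le _ _
        _ = ‖x‖ + t := by
          rw [norm_smul, norm_neg, PiLp.norm_single]; simp [abs_of_nonneg ht.1]
        _ < 1 := by linarith [ht.2]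
    · push Not at hp2
      set w : E3 := WithLp.toLp 2 (fun _ => ‖p‖ / √3) with hw
      have hwn : ‖p‖ = ‖w‖ := by
        rw [EuclideanSpace.norm_eq w, hw]
        simp only [Real.norm_eq_abs, sq_abs, Finset.sum_const, Finset.card_univ, Fintype.card_fin,
          div_pow]
        rw [Real.sq_sqrt (by norm_num)]
        have : (3 • (‖p‖ ^ 2 / 3) : ℝ) = ‖p‖^2 := by simp; ring
        rw [this, Real.sqrt_sq (norm_nonneg _)]
      set R : E3 ≃ₗᵢ[ℝ] E3 := Submodule.reflection (ℝ ∙ (p - w))ᗮ with hR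
      have hRp : R p = w := Submodule.reflection_sub hwn
      have hRs : R.symm = R := Submodule.reflection_symm
      set U : Set E3 := {x | ∀ i : Fin 3, 1/8 < x i} with hU
      have hUo : IsOpen U := by
        rw [hU, Set.ofPred_forall]
        exact isOpen_iInter_of_finite fun i => isOpen_lt continuous_const (by fun_prop)
      have hwU : w ∈ U := by
        intro i
        simp only [hw]
        rw [lt_div_iff₀ (by positivity)]
        have : √3 < 2 := by rw [Real.sqrt_lt' (by norm_num)]; norm_num
        linarith
      refine ⟨R ⁻¹' U, mem_nhdsWithin_of_mem_nhds
        ((hUo.preimage R.continuous).mem_nhds (by simpa [hRp] using hwU)), 1, fun f H h1 h2 => ?_⟩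
      rw [ENNReal.coe_one, one_mul]
      have := sob_local_rot R f H h1 h2 (U ∩ ball3) (hUo.measurableSet.inter hb) ?_
      · rw [hRs, Set.preimage_inter, ball3_preimage] at this
        exact this
      · rintro x ⟨hx, hxb⟩ i t ht
        simp only [mem_ball_zero_iff, ball3] at hxb ⊢
        have hxi := hx i
        refine lt_of_le_of_lt ?_ hxb
        rw [← sq_le_sq₀ (norm_nonneg _) (norm_nonneg _), norm_add_sq_real, inner_smul_right,
          inner_neg_right, norm_smul, norm_neg, PiLp.norm_single]
        have : inner ℝ x (EuclideanSpace.single i (1:ℝ)) = x i := by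
          rw [EuclideanSpace.inner_single_right]; simp
        rw [this]
        simp only [Real.norm_eq_abs, abs_of_nonneg ht.1, abs_one]
        nlinarith [ht.1, ht.2]

theorem isCompact_cball3 : IsCompact cball3 := isCompact_closedBall 0 1
theorem measurableSet_ball3 : MeasurableSet ball3 := Metric.isOpen_ball.measurableSet
theorem ball3_subset : ball3 ⊆ cball3 := Metric.ball_subset_closedBall

theorem integrableOn_cont {f : E3 → ℝ} (hf : ContinuousOn f cball3) : IntegrableOn f ball3 :=
  (hf.integrableOn_compact isCompact_cball3).mono_set ball3_subset

theorem integrable_supp {f : E3 → ℝ} (hf : ContinuousOn f cball3) (hs : Function.support f ⊆ cball3) :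
    Integrable f :=
  (integrableOn_iff_integrable_of_support_subset hs).1 (hf.integrableOn_compact isCompact_cball3)

/-- cutoff -/
noncomputable def eta (n : ℕ) (x : E3) : ℝ := Real.smoothTransition (n * (1 - ‖x‖ ^ 2) - 1)

noncomputable def kap (n : ℕ) (x : E3) : ℝ :=
  2 * n * deriv Real.smoothTransition (n * (1 - ‖x‖ ^ 2) - 1)

theorem smoothTransition_mono' : Monotone Real.smoothTransition := by
  have := @Real.smoothTransition.monotone
  exact this

theorem st_diff : ContDiff ℝ 1 Real.smoothTransition := Real.smoothTransition.contDiff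

theorem eta_cont (n : ℕ) : Continuous (eta n) := by
  unfold eta
  exact st_diff.continuous.comp (by fun_prop)

theorem kap_cont (n : ℕ) : Continuous (kap n) := by
  unfold kap
  exact continuous_const.mul ((st_diff.continuous_deriv le_rfl).comp (by fun_prop))

theorem kap_nonneg (n : ℕ) (x : E3) : 0 ≤ kap n x := by
  unfold kap
  have := smoothTransition_mono'.deriv_nonneg (x := n * (1 - ‖x‖ ^ 2) - 1)
  positivity

theorem kap_eq_zero_left (n : ℕ) (x : E3) (h : n * (1 - ‖x‖ ^ 2) ≤ 1) : kap n x = 0 := by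
  unfold kap
  have : IsLocalMin Real.smoothTransition (n * (1 - ‖x‖ ^ 2) - 1) := by
    apply Filter.Eventually.of_forall
    intro y
    rw [Real.smoothTransition.zero_of_nonpos (by linarith)]
    exact Real.smoothTransition.nonneg y
  rw [this.deriv_eq_zero, mul_zero]

theorem kap_eq_zero_right (n : ℕ) (x : E3) (h : 2 ≤ n * (1 - ‖x‖ ^ 2)) : kap n x = 0 := by
  unfold kap
  have : IsLocalMax Real.smoothTransition (n * (1 - ‖x‖ ^ 2) - 1) := by
    apply Filter.Eventually.of_forall
    intro y
    rw [Real.smoothTransition.one_of_one_le (x := n * (1 - ‖x‖ ^ 2) - 1) (by linarith)]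
    exact Real.smoothTransition.le_one y
  rw [this.deriv_eq_zero, mul_zero]

theorem eta_eq_zero (n : ℕ) (x : E3) (h : n * (1 - ‖x‖ ^ 2) ≤ 1) : eta n x = 0 :=
  Real.smoothTransition.zero_of_nonpos (by linarith)

theorem not_ball_le (n : ℕ) (x : E3) (h : x ∉ ball3) : n * (1 - ‖x‖ ^ 2) ≤ 1 := by
  simp only [ball3, mem_ball_zero_iff, not_lt] at h
  have : (n : ℝ) ≥ 0 := by positivity
  nlinarith [mul_nonneg this (by nlinarith : 0 ≤ ‖x‖ ^ 2 - 1)]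

theorem eta_tsupport (n : ℕ) : tsupport (eta n) ⊆ ball3 := by
  have h : tsupport (eta n) ⊆ {x : E3 | 1 ≤ n * (1 - ‖x‖ ^ 2)} := by
    apply closure_minimal
    · intro x hx
      by_contra h
      simp only [Set.mem_ofPred_eq, not_le] at h
      exact hx (eta_eq_zero n x h.le)
    · exact isClosed_le continuous_const (by fun_prop)
  refine h.trans fun x hx => ?_
  simp only [ball3, mem_ball_zero_iff]
  simp only [Set.mem_ofPred_eq] at hx
  by_contra hc
  push Not at hc
  have : (n : ℝ) ≥ 0 := by positivity
  nlinarith [mul_nonneg this (by nlinarith : 0 ≤ ‖x‖ ^ 2 - 1)]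

theorem eta_hasFDerivAt (n : ℕ) (x : E3) :
    HasFDerivAt (eta n) (-(kap n x) • innerSL ℝ x) x := by
  have h1 : HasFDerivAt (fun x : E3 => n * (1 - ‖x‖ ^ 2) - 1) (-(2 * n : ℝ) • innerSL ℝ x) x := by
    have := (((hasStrictFDerivAt_norm_sq x).hasFDerivAt.const_sub 1).const_mul (n : ℝ)).sub_const 1
    refine this.congr_fderiv ?_
    ext y; simp; ring
  have h2 := ((st_diff.differentiable one_ne_zero) (n * (1 - ‖x‖ ^ 2) - 1)).hasDerivAt
  have := h2.comp_hasFDerivAt x h1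
  refine this.congr_fderiv ?_
  ext y; simp [kap]; ring

theorem ibp (n : ℕ) (F : E3 → ℝ) (F' : E3 → E3 →L[ℝ] ℝ) (i : Fin 3)
    (hF : ContinuousOn F cball3) (hd : ∀ x ∈ ball3, HasFDerivAt F (F' x) x)
    (hF' : ContinuousOn (fun x => F' x (EuclideanSpace.single i 1)) cball3) :
    ∫ x, eta n x * F' x (EuclideanSpace.single i 1) = ∫ x, kap n x * (x i * F x) := by
  have hs : ∀ f : E3 → ℝ, Function.support (fun x => eta n x * f x) ⊆ cball3 := by
    intro f x hx
    by_contra h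
    apply hx
    simp [eta_eq_zero n x (not_ball_le n x (fun h' => h (ball3_subset h')))]
  have hs' : ∀ f : E3 → ℝ, Function.support (fun x => kap n x * f x) ⊆ cball3 := by
    intro f x hx
    by_contra h
    apply hx
    simp [kap_eq_zero_left n x (not_ball_le n x (fun h' => h (ball3_subset h')))]
  have hin : ∀ x : E3, (-(kap n x) • innerSL ℝ x) (EuclideanSpace.single i 1) * F x
      = - (kap n x * (x i * F x)) := by
    intro x
    simp [EuclideanSpace.inner_single_right]; ring
  have := integral_bilinear_hasFDerivAt_right_eq_neg_left_of_integrable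
    (μ := (volume : Measure E3)) (B := ContinuousLinearMap.mul ℝ ℝ) (f := eta n)
    (f' := fun x => -(kap n x) • innerSL ℝ x) (g := F) (g' := F') (v := EuclideanSpace.single i 1)
    ?_ ?_ ?_ (fun x _ => eta_hasFDerivAt n x) (fun x hx => hd x (eta_tsupport n hx))
  · simp only [ContinuousLinearMap.mul_apply', hin, integral_neg, neg_neg] at this
    exact this
  · simp only [ContinuousLinearMap.mul_apply', hin]
    refine (integrable_supp ?_ (hs' _)).neg
    exact (kap_cont n).continuousOn.mul (ContinuousOn.mul (by fun_prop) hF)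
  · simp only [ContinuousLinearMap.mul_apply']
    exact integrable_supp ((eta_cont n).continuousOn.mul hF') (hs _)
  · simp only [ContinuousLinearMap.mul_apply']
    exact integrable_supp ((eta_cont n).continuousOn.mul hF) (hs _)
theorem div_zero' (F : Fin 3 → E3 → ℝ) (F' : Fin 3 → E3 → E3 →L[ℝ] ℝ)
    (hF : ∀ i, ContinuousOn (F i) cball3) (hd : ∀ i, ∀ x ∈ ball3, HasFDerivAt (F i) (F' i x) x)
    (hF' : ∀ i, ContinuousOn (fun x => F' i x (EuclideanSpace.single i 1)) cball3)
    (h0 : ∀ x : E3, ‖x‖ = 1 → ∑ i, x i * F i x = 0) :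
    ∫ x in ball3, ∑ i, F' i x (EuclideanSpace.single i 1) = 0 := by
  set D : E3 → ℝ := fun x => ∑ i, F' i x (EuclideanSpace.single i 1) with hD
  set w : E3 → ℝ := fun x => ∑ i, x i * F i x with hw
  have hDc : ContinuousOn D cball3 := continuousOn_finsetSum _ fun i _ => hF' i
  have hwc : ContinuousOn w cball3 :=
    continuousOn_finsetSum _ fun i _ => ContinuousOn.mul (by fun_prop) (hF i)
  have hs : ∀ n, ∀ f : E3 → ℝ, Function.support (fun x => eta n x * f x) ⊆ cball3 := by
    intro n f x hx
    by_contra h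
    apply hx
    simp [eta_eq_zero n x (not_ball_le n x (fun h' => h (ball3_subset h')))]
  have hs' : ∀ n, ∀ f : E3 → ℝ, Function.support (fun x => kap n x * f x) ⊆ cball3 := by
    intro n f x hx
    by_contra h
    apply hx
    simp [kap_eq_zero_left n x (not_ball_le n x (fun h' => h (ball3_subset h')))]
  have hie : ∀ n, ∀ f : E3 → ℝ, ContinuousOn f cball3 → Integrable (fun x => eta n x * f x) :=
    fun n f hf => integrable_supp ((eta_cont n).continuousOn.mul hf) (hs n f)
  have hik : ∀ n, ∀ f : E3 → ℝ, ContinuousOn f cball3 → Integrable (fun x => kap n x * f x) :=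
    fun n f hf => integrable_supp ((kap_cont n).continuousOn.mul hf) (hs' n f)
  have e1 : ∀ n, ∫ x, eta n x * D x = ∫ x, kap n x * w x := by
    intro n
    simp only [hD, hw, Finset.mul_sum]
    rw [integral_finsetSum _ (fun i _ => hie n _ (hF' i)),
      integral_finsetSum _ (fun i _ => hik n (fun x => x i * F i x) (ContinuousOn.mul (by fun_prop) (hF i)))]
    exact Finset.sum_congr rfl fun i _ => ibp n (F i) (F' i) i (hF i) (hd i) (hF' i)
  have e2 : ∀ n, ∫ x, kap n x * ‖x‖ ^ 2 = 3 * ∫ x, eta n x := by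
    intro n
    have : ∀ i : Fin 3, ∫ x : E3, eta n x = ∫ x : E3, kap n x * (x i * x i) := by
      intro i
      have := ibp n (fun x => x i) (fun _ => EuclideanSpace.proj i) i (by fun_prop)
        (fun x _ => (EuclideanSpace.proj (𝕜 := ℝ) i : E3 →L[ℝ] ℝ).hasFDerivAt)
        (by fun_prop)
      simpa using this
    have h3 : ∫ x : E3, kap n x * ‖x‖ ^ 2 = ∑ i : Fin 3, ∫ x : E3, kap n x * (x i * x i) := by
      rw [← integral_finsetSum _ (fun i _ => hik n _ (by fun_prop))]
      congr 1; ext x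
      rw [← Finset.mul_sum, EuclideanSpace.norm_sq_eq]
      simp [pow_two]
    rw [h3, ← Finset.sum_congr rfl (fun i _ => this i)]
    simp
  have hvol : ∀ n, ∫ x, eta n x ≤ volume.real ball3 := by
    intro n
    have : ∫ x, eta n x = ∫ x in ball3, eta n x := by
      rw [setIntegral_eq_integral_of_forall_compl_eq_zero]
      intro x hx
      exact eta_eq_zero n x (not_ball_le n x hx)
    rw [this]
    calc _ ≤ ∫ x in ball3, (1 : ℝ) := by
          apply setIntegral_mono_on _ _ measurableSet_ball3
          · intro x _; exact Real.smoothTransition.le_one _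
          · exact integrableOn_cont (eta_cont n).continuousOn
          · exact integrableOn_cont continuousOn_const
      _ = _ := by simp
  have hlim : Filter.Tendsto (fun n => ∫ x, eta n x * D x) Filter.atTop (nhds (∫ x in ball3, D x)) := by
    have : ∀ n, ∫ x, eta n x * D x = ∫ x in ball3, eta n x * D x := by
      intro n
      rw [setIntegral_eq_integral_of_forall_compl_eq_zero]
      intro x hx
      rw [eta_eq_zero n x (not_ball_le n x hx), zero_mul]
    simp only [this]
    apply tendsto_integral_of_dominated_convergence (fun x => ‖D x‖)
    · intro n
      exact (integrableOn_cont ((eta_cont n).continuousOn.mul hDc)).aestronglyMeasurable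
    · exact (integrableOn_cont hDc).norm
    · intro n
      refine Filter.Eventually.of_forall fun x => ?_
      rw [norm_mul]
      have h1 : ‖eta n x‖ ≤ 1 := by
        unfold eta
        rw [Real.norm_of_nonneg (Real.smoothTransition.nonneg _)]
        exact Real.smoothTransition.le_one _
      exact mul_le_of_le_one_left (norm_nonneg _) h1
    · refine (ae_restrict_iff' measurableSet_ball3).2 (Filter.Eventually.of_forall fun x hx => ?_)
      apply tendsto_nhds_of_eventually_eq
      have hx' : 0 < 1 - ‖x‖ ^ 2 := by
        simp only [ball3, mem_ball_zero_iff] at hx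
        nlinarith [norm_nonneg x]
      obtain ⟨N, hN⟩ := exists_nat_ge (2 / (1 - ‖x‖ ^ 2))
      filter_upwards [Filter.eventually_ge_atTop N] with n hn
      have : 2 ≤ n * (1 - ‖x‖ ^ 2) := by
        rw [← div_le_iff₀ hx']
        exact hN.trans (by exact_mod_cast hn)
      unfold eta
      rw [Real.smoothTransition.one_of_one_le (by linarith), one_mul]
  have hsmall : ∀ ε > 0, |∫ x in ball3, D x| ≤ ε * (6 * volume.real ball3) := by
    intro ε hε
    obtain ⟨δ, hδ1, hδ⟩ : ∃ δ < (1 : ℝ), ∀ x ∈ cball3, δ < ‖x‖ ^ 2 → |w x| ≤ ε := by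
      set Z : Set E3 := {x ∈ cball3 | ε ≤ |w x|} with hZ
      have hZc : IsCompact Z := by
        have : Z = cball3 ∩ (fun x => |w x|) ⁻¹' Set.Ici ε := rfl
        rw [this]
        exact isCompact_cball3.of_isClosed_subset
          (hwc.abs.preimage_isClosed_of_isClosed isCompact_cball3.isClosed isClosed_Ici)
          Set.inter_subset_left
      rcases Z.eq_empty_or_nonempty with he | hne
      · refine ⟨0, by norm_num, fun x hx _ => ?_⟩
        by_contra h
        have : x ∈ Z := ⟨hx, (not_le.1 h).le⟩
        rw [he] at this; exact this
      · obtain ⟨x0, hx0, hmax⟩ := hZc.exists_isMaxOn hne (continuous_norm.pow 2).continuousOn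
        refine ⟨‖x0‖ ^ 2, ?_, fun x hx hlt => ?_⟩
        · have h1 : ‖x0‖ ≤ 1 := by simpa [cball3] using hx0.1
          have h2 : ‖x0‖ ≠ 1 := by
            intro h
            have h3 := hx0.2
            simp only [hw, h0 x0 h, abs_zero] at h3
            linarith
          have h3 := lt_of_le_of_ne h1 h2
          nlinarith [norm_nonneg x0]
        · by_contra h
          have : x ∈ Z := ⟨hx, (not_le.1 h).le⟩
          have hm : ‖x‖ ^ 2 ≤ ‖x0‖ ^ 2 := hmax this
          linarith
    refine le_of_tendsto hlim.abs ?_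
    obtain ⟨N, hN⟩ := exists_nat_gt (2 / (1 - δ))
    filter_upwards [Filter.eventually_ge_atTop (max N 4)] with n hn
    have hnN : (N : ℝ) ≤ n := by exact_mod_cast (le_max_left _ _).trans hn
    have hn4 : (4 : ℝ) ≤ n := by exact_mod_cast (le_max_right _ _).trans hn
    have hpt : ∀ x, ‖kap n x * w x‖ ≤ (2 * ε) * (kap n x * ‖x‖ ^ 2) := by
      intro x
      by_cases h1 : n * (1 - ‖x‖ ^ 2) ≤ 1
      · simp [kap_eq_zero_left n x h1]
      by_cases h2 : 2 ≤ n * (1 - ‖x‖ ^ 2)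
      · simp [kap_eq_zero_right n x h2]
      push Not at h1 h2
      have hxb : x ∈ cball3 := by
        by_contra h
        exact absurd (not_ball_le n x (fun h' => h (ball3_subset h'))) (not_le.2 h1)
      have hx1 : δ < ‖x‖ ^ 2 := by
        have : 2 < n * (1 - δ) := by
          rw [← div_lt_iff₀ (by linarith)]; linarith
        by_contra hc
        push Not at hc
        nlinarith
      have hx2 : 1/2 ≤ ‖x‖ ^ 2 := by
        by_contra hc
        push Not at hc
        nlinarith
      have := hδ x hxb hx1
      rw [norm_mul, Real.norm_of_nonneg (kap_nonneg n x), Real.norm_eq_abs]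
      have hk := kap_nonneg n x
      calc kap n x * |w x| ≤ kap n x * ε := by gcongr
        _ ≤ kap n x * (2 * ε * ‖x‖ ^ 2) := by
          gcongr; nlinarith
        _ = _ := by ring
    calc |∫ x, eta n x * D x| = ‖∫ x, kap n x * w x‖ := by rw [e1, Real.norm_eq_abs]
      _ ≤ ∫ x, (2 * ε) * (kap n x * ‖x‖ ^ 2) :=
        norm_integral_le_of_norm_le ((hik n _ (by fun_prop)).const_mul _)
          (Filter.Eventually.of_forall hpt)
      _ = (2 * ε) * (3 * ∫ x, eta n x) := by rw [integral_const_mul, e2]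
      _ ≤ (2 * ε) * (3 * volume.real ball3) := by gcongr; exact hvol n
      _ = _ := by ring
  have hV : 0 ≤ volume.real ball3 := measureReal_nonneg
  by_contra hne
  have hpos : 0 < |∫ x in ball3, D x| := abs_pos.2 hne
  have := hsmall (|∫ x in ball3, D x| / (12 * volume.real ball3 + 12)) (by positivity)
  rw [div_mul_eq_mul_div, le_div_iff₀ (by positivity)] at this
  nlinarith

theorem uniq_cball3 : UniqueDiffOn ℝ cball3 := by
  apply uniqueDiffOn_convex (convex_closedBall _ _)
  change (interior (Metric.closedBall (0 : E3) 1)).Nonempty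
  rw [interior_closedBall _ one_ne_zero]
  exact ⟨0, by simp⟩

theorem cball3_nhds {x : E3} (hx : x ∈ ball3) : cball3 ∈ nhds x :=
  Filter.mem_of_superset (Metric.isOpen_ball.mem_nhds hx) ball3_subset

/-- partial derivative -/
noncomputable def PP (φ : E3 → ℝ) (j : Fin 3) (x : E3) : ℝ := grad3 φ x (EuclideanSpace.single j 1)

noncomputable def PP' (φ : E3 → ℝ) (j : Fin 3) (x : E3) : E3 →L[ℝ] ℝ :=
  fderivWithin ℝ (PP φ j) cball3 x

noncomputable def NN (φ : E3 → ℝ) (x : E3) : ℝ := ∑ j, PP φ j x ^ 2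

noncomputable def NN' (φ : E3 → ℝ) (x : E3) : E3 →L[ℝ] ℝ := ∑ j, (2 * PP φ j x) • PP' φ j x

theorem clm_expand (L : E3 →L[ℝ] ℝ) (v : E3) :
    L v = ∑ i, v i * L (EuclideanSpace.single i 1) := by
  have h : v = ∑ i, v i • EuclideanSpace.single i (1 : ℝ) := by
    ext k
    simp [Finset.sum_apply, Pi.single_apply]
  conv_lhs => rw [h]
  simp [map_sum]

theorem PP'_single (φ : E3 → ℝ) (i j : Fin 3) (x : E3) :
    PP' φ j x (EuclideanSpace.single i 1) = hess3 φ x i j := rfl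

theorem NN_nonneg (φ : E3 → ℝ) (x : E3) : 0 ≤ NN φ x := Finset.sum_nonneg fun _ _ => sq_nonneg _

theorem frob_nonneg (φ : E3 → ℝ) (x : E3) : 0 ≤ hessFrobSq φ x :=
  Finset.sum_nonneg fun _ _ => Finset.sum_nonneg fun _ _ => sq_nonneg _

theorem norm_grad_sq (φ : E3 → ℝ) (x : E3) : ‖grad3 φ x‖ ^ 2 = NN φ x := by
  set L := grad3 φ x
  set v : E3 := WithLp.toLp 2 (fun j => PP φ j x) with hv
  have hL : L = innerSL ℝ v := by
    ext y
    rw [clm_expand L y]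
    simp only [innerSL_apply_apply, PiLp.inner_apply, hv]
    simp [PP, L]
  rw [hL, innerSL_apply_norm, EuclideanSpace.norm_sq_eq]
  simp [hv, NN]

theorem norm_grad_rpow (φ : E3 → ℝ) (x : E3) (a : ℝ) : ‖grad3 φ x‖ ^ a = NN φ x ^ (a / 2) := by
  rw [← norm_grad_sq, ← Real.rpow_natCast, ← Real.rpow_mul (norm_nonneg _)]
  congr 1
  push_cast
  ring

theorem bil (a b : Fin 3 → ℝ) (M : Fin 3 → Fin 3 → ℝ) :
    |∑ i, ∑ j, a i * M i j * b j| ≤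
      √(∑ i, a i ^ 2) * √(∑ j, b j ^ 2) * √(∑ i, ∑ j, M i j ^ 2) := by
  have h1 : (∑ i, ∑ j, a i * M i j * b j) ^ 2 ≤
      ((∑ i, a i ^ 2) * (∑ j, b j ^ 2)) * (∑ i, ∑ j, M i j ^ 2) := by
    have := Finset.sum_mul_sq_le_sq_mul_sq (Finset.univ : Finset (Fin 3 × Fin 3))
      (fun p => a p.1 * b p.2) (fun p => M p.1 p.2)
    simp only [Fintype.sum_prod_type] at this
    have e : (∑ i, a i ^ 2) * (∑ j, b j ^ 2) = ∑ i, ∑ j, (a i * b j) ^ 2 := by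
      rw [Finset.sum_mul_sum]
      simp only [mul_pow]
    rw [e]
    refine le_trans (le_of_eq ?_) this
    congr 1
    exact Finset.sum_congr rfl fun i _ => Finset.sum_congr rfl fun j _ => by ring
  rw [← Real.sqrt_mul (by positivity), ← Real.sqrt_mul (by positivity)]
  exact Real.abs_le_sqrt h1

section
variable {φ : E3 → ℝ} (hφ : ContDiffOn ℝ 2 φ cball3)

theorem PP_contDiffOn (hφ : ContDiffOn ℝ 2 φ cball3) (j : Fin 3) : ContDiffOn ℝ 1 (PP φ j) cball3 := by
  have h1 : ContDiffOn ℝ 1 (fun x => grad3 φ x) cball3 :=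
    hφ.fderivWithin uniq_cball3 (by norm_num)
  exact h1.clm_apply contDiffOn_const

theorem PP_cont (hφ : ContDiffOn ℝ 2 φ cball3) (j : Fin 3) : ContinuousOn (PP φ j) cball3 :=
  (PP_contDiffOn hφ j).continuousOn

theorem hess_cont (hφ : ContDiffOn ℝ 2 φ cball3) (i j : Fin 3) :
    ContinuousOn (fun x => hess3 φ x i j) cball3 := by
  have h1 : ContinuousOn (fun x => PP' φ j x) cball3 :=
    (PP_contDiffOn hφ j).continuousOn_fderivWithin uniq_cball3 le_rfl
  exact h1.clm_apply continuousOn_const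

theorem NN_cont (hφ : ContDiffOn ℝ 2 φ cball3) : ContinuousOn (NN φ) cball3 :=
  continuousOn_finsetSum _ fun j _ => (PP_cont hφ j).pow 2

theorem frob_cont (hφ : ContDiffOn ℝ 2 φ cball3) : ContinuousOn (hessFrobSq φ) cball3 :=
  continuousOn_finsetSum _ fun i _ => continuousOn_finsetSum _ fun j _ => (hess_cont hφ i j).pow 2

theorem NN_rpow_cont (hφ : ContDiffOn ℝ 2 φ cball3) {a : ℝ} (ha : 0 ≤ a) :
    ContinuousOn (fun x => NN φ x ^ a) cball3 :=
  (NN_cont hφ).rpow_const fun _ _ => Or.inr ha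

theorem phi_deriv (hφ : ContDiffOn ℝ 2 φ cball3) {x : E3} (hx : x ∈ ball3) :
    HasFDerivAt φ (grad3 φ x) x :=
  ((hφ.differentiableOn two_ne_zero) x (ball3_subset hx)).hasFDerivWithinAt.hasFDerivAt
    (cball3_nhds hx)

theorem PP_deriv (hφ : ContDiffOn ℝ 2 φ cball3) {x : E3} (hx : x ∈ ball3) (j : Fin 3) :
    HasFDerivAt (PP φ j) (PP' φ j x) x :=
  (((PP_contDiffOn hφ j).differentiableOn one_ne_zero) x
    (ball3_subset hx)).hasFDerivWithinAt.hasFDerivAt (cball3_nhds hx)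

theorem NN_deriv (hφ : ContDiffOn ℝ 2 φ cball3) {x : E3} (hx : x ∈ ball3) :
    HasFDerivAt (NN φ) (NN' φ x) x := by
  have := HasFDerivAt.fun_sum (u := Finset.univ) fun j _ => (PP_deriv hφ hx j).pow 2
  unfold NN
  refine this.congr_fderiv ?_
  ext y; simp [NN']

theorem NN_rpow_deriv (hφ : ContDiffOn ℝ 2 φ cball3) {x : E3} (hx : x ∈ ball3) {a : ℝ} (ha : 1 ≤ a) :
    HasFDerivAt (fun y => NN φ y ^ a) ((a * NN φ x ^ (a - 1)) • NN' φ x) x :=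
  (Real.hasDerivAt_rpow_const (p := a) (x := NN φ x) (Or.inr ha)).comp_hasFDerivAt x (NN_deriv hφ hx)

theorem NN'_apply (φ : E3 → ℝ) (x v : E3) :
    NN' φ x v = 2 * ∑ i, ∑ j, v i * hess3 φ x i j * PP φ j x := by
  simp only [NN', _root_.sum_apply, _root_.smul_apply, smul_eq_mul]
  rw [Finset.sum_comm, Finset.mul_sum]
  refine Finset.sum_congr rfl fun j _ => ?_
  rw [clm_expand (PP' φ j x) v, Finset.mul_sum, Finset.mul_sum]
  refine Finset.sum_congr rfl fun i _ => ?_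
  rw [PP'_single]; ring

theorem NN'_bound (φ : E3 → ℝ) (x v : E3) :
    |NN' φ x v| ≤ 2 * (‖v‖ * √(NN φ x) * √(hessFrobSq φ x)) := by
  rw [NN'_apply, abs_mul, abs_two]
  have := bil (fun i => v i) (fun j => PP φ j x) (fun i j => hess3 φ x i j)
  have e : ‖v‖ = √(∑ i, v i ^ 2) := by
    rw [EuclideanSpace.norm_eq]; simp
  rw [e]
  unfold NN hessFrobSq
  linarith

theorem tr_bound (φ : E3 → ℝ) (x : E3) : |∑ i, hess3 φ x i i| ≤ 2 * √(hessFrobSq φ x) := by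
  have : (2 : ℝ) = √4 := by
    rw [show (4 : ℝ) = 2 ^ 2 by norm_num, Real.sqrt_sq (by norm_num)]
  rw [this, ← Real.sqrt_mul (by norm_num)]
  apply Real.abs_le_sqrt
  unfold hessFrobSq
  simp only [Fin.sum_univ_three]
  set a := hess3 φ x 0 0
  set b := hess3 φ x 1 1
  set c := hess3 φ x 2 2
  nlinarith [sq_nonneg (a - b), sq_nonneg (a - c), sq_nonneg (b - c), sq_nonneg (hess3 φ x 0 1),
    sq_nonneg (hess3 φ x 0 2), sq_nonneg (hess3 φ x 1 0), sq_nonneg (hess3 φ x 1 2),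
    sq_nonneg (hess3 φ x 2 0), sq_nonneg (hess3 φ x 2 1), sq_nonneg a, sq_nonneg b, sq_nonneg c]
end

/-- first integral inequality -/
theorem int_ineq1 {φ : E3 → ℝ} (hφ : ContDiffOn ℝ 2 φ cball3)
    (hbd : ∀ x : E3, ‖x‖ = 1 → φ x * grad3 φ x x = 0) {q M : ℝ} (hq : 1 ≤ q)
    (hM : ∀ x ∈ ball3, |φ x| ≤ M) :
    ∫ x in ball3, NN φ x ^ (q + 1) ≤
      (2 + 2 * q) ^ 2 * M ^ 2 * ∫ x in ball3, NN φ x ^ (q - 1) * hessFrobSq φ x := by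
  set F : Fin 3 → E3 → ℝ := fun i x => φ x * (NN φ x ^ q * PP φ i x) with hF
  set F' : Fin 3 → E3 → E3 →L[ℝ] ℝ := fun i x => φ x • (NN φ x ^ q • PP' φ i x +
    PP φ i x • ((q * NN φ x ^ (q - 1)) • NN' φ x)) + (NN φ x ^ q * PP φ i x) • grad3 φ x with hF'
  have hφc : ContinuousOn φ cball3 := hφ.continuousOn
  have hNq := NN_rpow_cont hφ (show 0 ≤ q by linarith)
  have hNq1 := NN_rpow_cont hφ (show 0 ≤ q - 1 by linarith)
  have hNN'c : ∀ i : Fin 3, ContinuousOn (fun x => NN' φ x (EuclideanSpace.single i 1)) cball3 := by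
    intro i
    simp only [NN'_apply]
    exact continuousOn_const.mul (continuousOn_finsetSum _ fun k _ => continuousOn_finsetSum _ fun j _ =>
      (continuousOn_const.mul (hess_cont hφ k j)).mul (PP_cont hφ j))
  have hdiv0 := div_zero' F F' (fun i => hφc.mul (hNq.mul (PP_cont hφ i)))
    (fun i x hx => (phi_deriv hφ hx).mul ((NN_rpow_deriv hφ hx hq).mul (PP_deriv hφ hx i)))
    (fun i => by
      simp only [hF', _root_.add_apply, _root_.smul_apply, smul_eq_mul,
        PP'_single]
      exact (hφc.mul ((hNq.mul (hess_cont hφ i i)).add ((PP_cont hφ i).mul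
        ((continuousOn_const.mul hNq1).mul (hNN'c i))))).add
        ((hNq.mul (PP_cont hφ i)).mul (PP_cont hφ i)))
    (fun x hx => by
      have h1 := hbd x hx
      rw [clm_expand] at h1
      have : ∑ i, x i * F i x = NN φ x ^ q * (φ x * ∑ i, x i * grad3 φ x (EuclideanSpace.single i 1)) := by
        simp only [hF, Finset.mul_sum, PP]
        exact Finset.sum_congr rfl fun i _ => by ring
      rw [this, h1, mul_zero])
  set D : E3 → ℝ := fun x => ∑ i, F' i x (EuclideanSpace.single i 1) with hD
  have hDc : ContinuousOn D cball3 := by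
    apply continuousOn_finsetSum _ fun i _ => ?_
    simp only [hF', _root_.add_apply, _root_.smul_apply, smul_eq_mul,
        PP'_single]
    exact (hφc.mul ((hNq.mul (hess_cont hφ i i)).add ((PP_cont hφ i).mul
        ((continuousOn_const.mul hNq1).mul (hNN'c i))))).add
        ((hNq.mul (PP_cont hφ i)).mul (PP_cont hφ i))
  have hDeq : ∀ x, D x = NN φ x ^ (q + 1) + φ x * (NN φ x ^ q * (∑ i, hess3 φ x i i) +
      q * NN φ x ^ (q - 1) * NN' φ x (WithLp.toLp 2 fun i => PP φ i x)) := by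
    intro x
    have h1 : NN φ x ^ (q + 1) = NN φ x ^ q * ∑ i, PP φ i x * PP φ i x := by
      rw [Real.rpow_add' (NN_nonneg φ x) (by linarith), Real.rpow_one]
      congr 1
      simp only [NN, pow_two]
    rw [h1, clm_expand (NN' φ x)]
    simp only [hD, hF', _root_.add_apply, _root_.smul_apply, smul_eq_mul,
      PP'_single, Finset.mul_sum, mul_add, ← Finset.sum_add_distrib]
    refine Finset.sum_congr rfl fun i _ => ?_
    have : grad3 φ x (EuclideanSpace.single i 1) = PP φ i x := rfl
    rw [this]
    ring
  have hpt : ∀ x ∈ ball3, NN φ x ^ (q + 1) ≤ 2 * D x + (2 + 2 * q) ^ 2 * M ^ 2 *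
      (NN φ x ^ (q - 1) * hessFrobSq φ x) := by
    intro x hx
    have hN := NN_nonneg φ x
    set N := NN φ x with hNdef
    set d := √(hessFrobSq φ x) with hd
    have hd2 : hessFrobSq φ x = d ^ 2 := (Real.sq_sqrt (frob_nonneg φ x)).symm
    have hd0 : 0 ≤ d := Real.sqrt_nonneg _
    set a := N ^ ((q + 1) / 2) with ha
    set b := N ^ ((q - 1) / 2) with hb
    have ha0 : 0 ≤ a := Real.rpow_nonneg hN _
    have hb0 : 0 ≤ b := Real.rpow_nonneg hN _
    have haa : N ^ (q + 1) = a ^ 2 := by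
      rw [ha, ← Real.rpow_natCast, ← Real.rpow_mul hN]; congr 1; push_cast; ring
    have hbb : N ^ (q - 1) = b ^ 2 := by
      rw [hb, ← Real.rpow_natCast, ← Real.rpow_mul hN]; congr 1; push_cast; ring
    have hab : N ^ q = a * b := by
      rw [ha, hb, ← Real.rpow_add' hN (by ring_nf; linarith)]; congr 1; ring
    have hbN : b ^ 2 * N = a * b := by
      rw [← hbb, ← hab]
      nth_rewrite 2 [← Real.rpow_one N]
      rw [← Real.rpow_add' hN (by ring_nf; linarith)]; congr 1; ring
    have hv : ‖(WithLp.toLp 2 fun i => PP φ i x : E3)‖ = √N := by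
      rw [EuclideanSpace.norm_eq]; simp [hNdef, NN]
    have h1 := NN'_bound φ x (WithLp.toLp 2 fun i => PP φ i x)
    rw [hv, Real.mul_self_sqrt hN] at h1
    have h2 := tr_bound φ x
    have hM0 : 0 ≤ M := (abs_nonneg _).trans (hM x hx)
    have h3 : |φ x * (N ^ q * (∑ i, hess3 φ x i i) +
      q * N ^ (q - 1) * NN' φ x (WithLp.toLp 2 fun i => PP φ i x))| ≤
        M * ((2 + 2 * q) * (a * b * d)) := by
      rw [abs_mul]
      refine mul_le_mul (hM x hx) ?_ (abs_nonneg _) hM0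
      refine (abs_add_le _ _).trans ?_
      rw [abs_mul, abs_mul, hab, hbb, abs_of_nonneg (mul_nonneg ha0 hb0),
        abs_of_nonneg (by positivity : 0 ≤ q * b ^ 2)]
      calc _ ≤ a * b * (2 * d) + q * b ^ 2 * (2 * (N * d)) := by gcongr
        _ = a * b * (2 * d) + q * (b ^ 2 * N) * (2 * d) := by ring
        _ = _ := by rw [hbN]; ring
    have h4 := hDeq x
    rw [h4, hd2, hbb, haa]
    have h5 := (abs_le.1 h3).1
    rw [hab, hbb] at h5 
    rw [hab]
    nlinarith [sq_nonneg (a - (2 + 2 * q) * M * (b * d))]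
  have hA := integrableOn_cont (NN_rpow_cont hφ (show 0 ≤ q + 1 by linarith))
  have hI : IntegrableOn (fun x => (2 + 2 * q) ^ 2 * M ^ 2 * (NN φ x ^ (q - 1) * hessFrobSq φ x)) ball3 :=
    integrableOn_cont (continuousOn_const.mul (hNq1.mul (frob_cont hφ)))
  have hD2 : IntegrableOn (fun x => 2 * D x) ball3 := (integrableOn_cont hDc).const_mul 2
  calc _ ≤ ∫ x in ball3, (2 * D x + (2 + 2 * q) ^ 2 * M ^ 2 *
      (NN φ x ^ (q - 1) * hessFrobSq φ x)) :=
        setIntegral_mono_on hA (hD2.add hI)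
          measurableSet_ball3 hpt
    _ = 2 * (∫ x in ball3, D x) + (2 + 2 * q) ^ 2 * M ^ 2 *
      ∫ x in ball3, (NN φ x ^ (q - 1) * hessFrobSq φ x) := by
        rw [integral_add hD2 hI,
          integral_const_mul, integral_const_mul]
    _ = _ := by rw [hdiv0]; ring

theorem seg1d (u u' k : ℝ → ℝ) (h : ∀ t ∈ Set.Icc (0 : ℝ) (1 / 4), HasDerivAt u (u' t) t)
    (hk : ContinuousOn k (Set.Icc (0 : ℝ) (1 / 4)))
    (hb : ∀ t ∈ Set.Icc (0 : ℝ) (1 / 4), |u' t| ≤ k t) :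
    u 0 ≤ ∫ t in Set.Icc (0 : ℝ) (1 / 4), (4 * u t + k t) := by
  have huc : ContinuousOn u (Set.Icc (0 : ℝ) (1 / 4)) :=
    fun t ht => (h t ht).continuousAt.continuousWithinAt
  have hki : IntegrableOn k (Set.Icc (0 : ℝ) (1 / 4)) := hk.integrableOn_compact isCompact_Icc
  have hui : IntegrableOn u (Set.Icc (0 : ℝ) (1 / 4)) := huc.integrableOn_compact isCompact_Icc
  set K := ∫ t in Set.Icc (0 : ℝ) (1 / 4), k t with hK
  have hp : ∀ t ∈ Set.Icc (0 : ℝ) (1 / 4), u 0 - K ≤ u t := by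
    intro t ht
    have hs : Set.Icc (0 : ℝ) t ⊆ Set.Icc (0 : ℝ) (1 / 4) := Set.Icc_subset_Icc_right ht.2
    have h1 := intervalIntegral.integral_le_sub_of_hasDeriv_right_of_le (g := u) (g' := u')
      (φ := fun t => -k t) ht.1 (huc.mono hs)
      (fun y hy => (h y (hs (Set.Ioo_subset_Icc_self hy))).hasDerivWithinAt)
      ((hki.mono_set hs).neg) (fun y hy => (abs_le.1 (hb y (hs (Set.Ioo_subset_Icc_self hy)))).1)
    rw [intervalIntegral.integral_neg, intervalIntegral.integral_of_le ht.1,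
      ← integral_Icc_eq_integral_Ioc] at h1
    have h2 : ∫ y in Set.Icc (0 : ℝ) t, k y ≤ K := by
      refine setIntegral_mono_set hki ?_ hs.eventuallyLE
      exact (ae_restrict_iff' measurableSet_Icc).2
        (Filter.Eventually.of_forall fun y hy => (abs_nonneg _).trans (hb y hy))
    linarith
  have h3 : ∫ t in Set.Icc (0 : ℝ) (1 / 4), (u 0 - K) ≤ ∫ t in Set.Icc (0 : ℝ) (1 / 4), u t :=
    setIntegral_mono_on (by simp) hui measurableSet_Icc hp
  rw [integral_add (hui.const_mul 4) hki, integral_const_mul]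
  rw [setIntegral_const] at h3
  simp [Measure.real] at h3
  linarith

theorem holder_real {u v : E3 → ℝ} (hu : ContinuousOn u cball3) (hv : ContinuousOn v cball3)
    (hu0 : ∀ x, 0 ≤ u x) (hv0 : ∀ x, 0 ≤ v x) {a b : ℝ} (ha : 0 ≤ a) (hb : 0 ≤ b) (hab : a + b = 1) :
    ∫ x in ball3, u x ^ a * v x ^ b ≤ (∫ x in ball3, u x) ^ a * (∫ x in ball3, v x) ^ b := by
  have hui := integrableOn_cont hu
  have hvi := integrableOn_cont hv
  have huvi : IntegrableOn (fun x => u x ^ a * v x ^ b) ball3 :=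
    integrableOn_cont ((hu.rpow_const fun _ _ => Or.inr ha).mul (hv.rpow_const fun _ _ => Or.inr hb))
  have hU : 0 ≤ ∫ x in ball3, u x := integral_nonneg hu0
  have hV : 0 ≤ ∫ x in ball3, v x := integral_nonneg hv0
  have h1 := ENNReal.lintegral_mul_norm_pow_le (μ := volume.restrict ball3)
    (f := fun x => ENNReal.ofReal (u x)) (g := fun x => ENNReal.ofReal (v x))
    hui.aestronglyMeasurable.aemeasurable.ennreal_ofReal
    hvi.aestronglyMeasurable.aemeasurable.ennreal_ofReal ha hb hab
  have e : ∀ x, ENNReal.ofReal (u x) ^ a * ENNReal.ofReal (v x) ^ b =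
      ENNReal.ofReal (u x ^ a * v x ^ b) := by
    intro x
    rw [ENNReal.ofReal_rpow_of_nonneg (hu0 x) ha, ENNReal.ofReal_rpow_of_nonneg (hv0 x) hb,
      ENNReal.ofReal_mul (Real.rpow_nonneg (hu0 x) _)]
  simp only [e] at h1
  rw [← ofReal_integral_eq_lintegral_ofReal hui (Filter.Eventually.of_forall hu0),
    ← ofReal_integral_eq_lintegral_ofReal hvi (Filter.Eventually.of_forall hv0),
    ← ofReal_integral_eq_lintegral_ofReal huvi (Filter.Eventually.of_forall fun x =>
      mul_nonneg (Real.rpow_nonneg (hu0 x) _) (Real.rpow_nonneg (hv0 x) _)),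
    ENNReal.ofReal_rpow_of_nonneg hU ha, ENNReal.ofReal_rpow_of_nonneg hV hb,
    ← ENNReal.ofReal_mul (Real.rpow_nonneg hU _)] at h1
  exact (ENNReal.ofReal_le_ofReal_iff (mul_nonneg (Real.rpow_nonneg hU _) (Real.rpow_nonneg hV _))).1 h1

theorem indicator_meas {g : E3 → ℝ} (hg : ContinuousOn g cball3) :
    Measurable (ball3.indicator fun x => ENNReal.ofReal (g x)) := by
  classical
  rw [← Set.piecewise_eq_indicator]
  exact ContinuousOn.measurable_piecewise
    (ENNReal.continuous_ofReal.comp_continuousOn (hg.mono ball3_subset)) continuousOn_const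
    measurableSet_ball3

noncomputable def HH (φ : E3 → ℝ) (q : ℝ) (x : E3) : ℝ :=
  4 * NN φ x ^ (2 * q) + 4 * q * (NN φ x ^ (2 * q - 1 / 2) * √(hessFrobSq φ x))

theorem HH_cont {φ : E3 → ℝ} (hφ : ContDiffOn ℝ 2 φ cball3) {q : ℝ} (hq : 1 ≤ q) :
    ContinuousOn (HH φ q) cball3 :=
  (continuousOn_const.mul (NN_rpow_cont hφ (by linarith))).add
    (continuousOn_const.mul ((NN_rpow_cont hφ (by linarith)).mul (frob_cont hφ).sqrt))

theorem HH_nonneg (φ : E3 → ℝ) {q : ℝ} (hq : 1 ≤ q) (x : E3) : 0 ≤ HH φ q x := by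
  have := Real.rpow_nonneg (NN_nonneg φ x) (2 * q)
  have := Real.rpow_nonneg (NN_nonneg φ x) (2 * q - 1 / 2)
  unfold HH
  positivity

theorem segHyp_NN {φ : E3 → ℝ} (hφ : ContDiffOn ℝ 2 φ cball3) {q : ℝ} (hq : 1 ≤ q) :
    SegHyp (fun x => ENNReal.ofReal (NN φ x ^ (2 * q))) (fun x => ENNReal.ofReal (HH φ q x)) := by
  intro x v hv hseg
  have hlc : ContinuousOn (fun t : ℝ => x + t • v) (Set.Icc (0 : ℝ) (1 / 4)) := by fun_prop
  have hmaps : Set.MapsTo (fun t : ℝ => x + t • v) (Set.Icc (0 : ℝ) (1 / 4)) cball3 :=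
    fun t ht => ball3_subset (hseg t ht)
  have h1 := seg1d (fun t => NN φ (x + t • v) ^ (2 * q))
    (fun t => ((2 * q * NN φ (x + t • v) ^ (2 * q - 1)) • NN' φ (x + t • v)) v)
    (fun t => 4 * q * (NN φ (x + t • v) ^ (2 * q - 1 / 2) * √(hessFrobSq φ (x + t • v))))
    (fun t ht => by
      have hd : HasDerivAt (fun t : ℝ => x + t • v) v t := by
        simpa using ((hasDerivAt_id t).smul_const v).const_add x
      exact (NN_rpow_deriv hφ (hseg t ht) (by linarith : 1 ≤ 2 * q)).comp_hasDerivAt t hd)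
    (ContinuousOn.comp (g := fun y => 4 * q * (NN φ y ^ (2 * q - 1 / 2) * √(hessFrobSq φ y)))
      (continuousOn_const.mul ((NN_rpow_cont hφ (by linarith)).mul (frob_cont hφ).sqrt)) hlc hmaps)
    (fun t ht => by
      set y := x + t • v
      have hN := NN_nonneg φ y
      have hb := NN'_bound φ y v
      rw [hv, one_mul] at hb
      have hr := Real.rpow_nonneg hN (2 * q - 1)
      rw [_root_.smul_apply, smul_eq_mul, abs_mul, abs_of_nonneg (by positivity)]
      have e : NN φ y ^ (2 * q - 1 / 2) = NN φ y ^ (2 * q - 1) * √(NN φ y) := by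
        rw [Real.sqrt_eq_rpow, ← Real.rpow_add' hN (by linarith)]; congr 1; ring
      rw [e]
      calc _ ≤ 2 * q * NN φ y ^ (2 * q - 1) * (2 * (√(NN φ y) * √(hessFrobSq φ y))) := by gcongr
        _ = _ := by ring)
  simp only [zero_smul, add_zero] at h1
  refine (ENNReal.ofReal_le_ofReal h1).trans ?_
  rw [ofReal_integral_eq_lintegral_ofReal]
  · exact le_rfl
  · exact ((HH_cont hφ hq).comp hlc hmaps).integrableOn_compact isCompact_Icc
  · exact Filter.Eventually.of_forall fun t => HH_nonneg φ hq (x + t • v)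

theorem J_bound1 : ∃ C : ℝ, 0 ≤ C ∧ ∀ (φ : E3 → ℝ) (q : ℝ), ContDiffOn ℝ 2 φ cball3 → 1 ≤ q →
    ∫ x in ball3, NN φ x ^ (3 * q) ≤ C * (∫ x in ball3, HH φ q x) ^ (3 / 2 : ℝ) := by
  obtain ⟨C, hC⟩ := sobolev
  refine ⟨C, C.2, fun φ q hφ hq => ?_⟩
  have h := hC _ _ (indicator_meas (HH_cont hφ hq)) (segHyp_NN hφ hq)
  have e : ∀ x, ENNReal.ofReal (NN φ x ^ (2 * q)) ^ (3 / 2 : ℝ) = ENNReal.ofReal (NN φ x ^ (3 * q)) := by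
    intro x
    rw [ENNReal.ofReal_rpow_of_nonneg (Real.rpow_nonneg (NN_nonneg φ x) _) (by norm_num),
      ← Real.rpow_mul (NN_nonneg φ x)]
    congr 2; ring
  simp only [e] at h
  have hT : 0 ≤ ∫ x in ball3, HH φ q x := integral_nonneg (HH_nonneg φ hq)
  rw [← ofReal_integral_eq_lintegral_ofReal (integrableOn_cont (NN_rpow_cont hφ (by linarith)))
      (Filter.Eventually.of_forall fun x => Real.rpow_nonneg (NN_nonneg φ x) _),
    ← ofReal_integral_eq_lintegral_ofReal (integrableOn_cont (HH_cont hφ hq))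
      (Filter.Eventually.of_forall fun x => HH_nonneg φ hq x),
    ENNReal.ofReal_rpow_of_nonneg hT (by norm_num), ← ENNReal.ofReal_coe_nnreal,
    ← ENNReal.ofReal_mul C.coe_nonneg] at h
  exact (ENNReal.ofReal_le_ofReal_iff (mul_nonneg C.2 (Real.rpow_nonneg hT _))).1 h

theorem T_bound {φ : E3 → ℝ} (hφ : ContDiffOn ℝ 2 φ cball3) {q : ℝ} (hq : 1 ≤ q) :
    ∫ x in ball3, HH φ q x ≤ (4 * (1 + q)) * (∫ x in ball3, NN φ x ^ (3 * q)) ^ (1 / 2 : ℝ) *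
      ((∫ x in ball3, NN φ x ^ (q - 1) * hessFrobSq φ x) + ∫ x in ball3, NN φ x ^ q) ^ (1 / 2 : ℝ) := by
  have hN := NN_nonneg φ
  have hr : ∀ (a : ℝ) (x : E3), 0 ≤ NN φ x ^ a := fun a x => Real.rpow_nonneg (hN x) _
  have hG : ∀ x, 0 ≤ NN φ x ^ (q - 1) * hessFrobSq φ x := fun x => mul_nonneg (hr _ x) (frob_nonneg φ x)
  have hJc := NN_rpow_cont hφ (show 0 ≤ 3 * q by linarith)
  have hKc := NN_rpow_cont hφ (show 0 ≤ q by linarith)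
  have hIc : ContinuousOn (fun x => NN φ x ^ (q - 1) * hessFrobSq φ x) cball3 :=
    (NN_rpow_cont hφ (show 0 ≤ q - 1 by linarith)).mul (frob_cont hφ)
  have h1 := holder_real hJc hKc (hr _) (hr _) (a := 1 / 2) (b := 1 / 2) (by norm_num) (by norm_num)
    (by norm_num)
  have h2 := holder_real hJc hIc (hr _) hG (a := 1 / 2) (b := 1 / 2) (by norm_num) (by norm_num)
    (by norm_num)
  have e1 : ∀ x, (NN φ x ^ (3 * q)) ^ (1 / 2 : ℝ) * (NN φ x ^ q) ^ (1 / 2 : ℝ) = NN φ x ^ (2 * q) := by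
    intro x
    rw [← Real.rpow_mul (hN x), ← Real.rpow_mul (hN x), ← Real.rpow_add' (hN x) (by ring_nf; linarith)]
    congr 1; ring
  have e2 : ∀ x, (NN φ x ^ (3 * q)) ^ (1 / 2 : ℝ) * (NN φ x ^ (q - 1) * hessFrobSq φ x) ^ (1 / 2 : ℝ) =
      NN φ x ^ (2 * q - 1 / 2) * √(hessFrobSq φ x) := by
    intro x
    rw [Real.mul_rpow (hr _ x) (frob_nonneg φ x), ← Real.sqrt_eq_rpow (hessFrobSq φ x), ← mul_assoc,
      ← Real.rpow_mul (hN x), ← Real.rpow_mul (hN x), ← Real.rpow_add' (hN x) (by ring_nf; linarith)]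
    congr 2; ring
  simp only [e1] at h1
  simp only [e2] at h2
  set J := ∫ x in ball3, NN φ x ^ (3 * q)
  set I := ∫ x in ball3, NN φ x ^ (q - 1) * hessFrobSq φ x with hI
  set K := ∫ x in ball3, NN φ x ^ q with hK
  have hI0 : 0 ≤ I := integral_nonneg hG
  have hK0 : 0 ≤ K := integral_nonneg (hr _)
  have hJ0 : 0 ≤ J := integral_nonneg (hr _)
  have hi1 : IntegrableOn (fun x => 4 * NN φ x ^ (2 * q)) ball3 :=
    integrableOn_cont (continuousOn_const.mul (NN_rpow_cont hφ (by linarith)))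
  have hi2 : IntegrableOn (fun x => 4 * q * (NN φ x ^ (2 * q - 1 / 2) * √(hessFrobSq φ x))) ball3 :=
    integrableOn_cont (continuousOn_const.mul ((NN_rpow_cont hφ (by linarith)).mul (frob_cont hφ).sqrt))
  unfold HH
  rw [integral_add hi1 hi2, integral_const_mul, integral_const_mul]
  have hJr := Real.rpow_nonneg hJ0 (1 / 2)
  have m1 : K ^ (1 / 2 : ℝ) ≤ (I + K) ^ (1 / 2 : ℝ) :=
    Real.rpow_le_rpow hK0 (by linarith) (by norm_num)
  have m2 : I ^ (1 / 2 : ℝ) ≤ (I + K) ^ (1 / 2 : ℝ) :=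
    Real.rpow_le_rpow hI0 (by linarith) (by norm_num)
  have m3 := h1.trans (mul_le_mul_of_nonneg_left m1 hJr)
  have m4 := h2.trans (mul_le_mul_of_nonneg_left m2 hJr)
  have m5 := mul_le_mul_of_nonneg_left m4 (by linarith : 0 ≤ 4 * q)
  linarith

theorem J_alg {J S T C c : ℝ} (hJ : 0 ≤ J) (hS : 0 ≤ S) (hT0 : 0 ≤ T) (hC : 0 ≤ C) (hc : 0 ≤ c)
    (h1 : J ≤ C * T ^ (3 / 2 : ℝ)) (h2 : T ≤ c * J ^ (1 / 2 : ℝ) * S ^ (1 / 2 : ℝ)) :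
    J ≤ C ^ 4 * c ^ 6 * S ^ 3 := by
  rcases hJ.eq_or_lt with h0 | hJp
  · rw [← h0]; positivity
  have h3 : T ^ (3 / 2 : ℝ) ≤ (c * J ^ (1 / 2 : ℝ) * S ^ (1 / 2 : ℝ)) ^ (3 / 2 : ℝ) :=
    Real.rpow_le_rpow hT0 h2 (by norm_num)
  have h4 : J ≤ C * (c * J ^ (1 / 2 : ℝ) * S ^ (1 / 2 : ℝ)) ^ (3 / 2 : ℝ) :=
    h1.trans (mul_le_mul_of_nonneg_left h3 hC)
  have h5 : J ^ 4 ≤ (C * (c * J ^ (1 / 2 : ℝ) * S ^ (1 / 2 : ℝ)) ^ (3 / 2 : ℝ)) ^ 4 :=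
    pow_le_pow_left₀ hJ h4 4
  have h6 : (C * (c * J ^ (1 / 2 : ℝ) * S ^ (1 / 2 : ℝ)) ^ (3 / 2 : ℝ)) ^ 4 = C ^ 4 * c ^ 6 * S ^ 3 * J ^ 3 := by
    have e : ∀ y : ℝ, 0 ≤ y → (y ^ (3 / 2 : ℝ)) ^ 4 = y ^ 6 := by
      intro y hy
      rw [← Real.rpow_natCast, ← Real.rpow_mul hy, ← Real.rpow_natCast]
      norm_num
    have e' : ∀ y : ℝ, 0 ≤ y → (y ^ (1 / 2 : ℝ)) ^ 6 = y ^ 3 := by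
      intro y hy
      rw [← Real.rpow_natCast, ← Real.rpow_mul hy, ← Real.rpow_natCast]
      norm_num
    rw [mul_pow, e _ (by positivity), mul_pow, mul_pow, e' _ hJ, e' _ hS]; ring
  rw [h6] at h5
  have : J * J ^ 3 ≤ (C ^ 4 * c ^ 6 * S ^ 3) * J ^ 3 := by linarith [h5, show J * J ^ 3 = J ^ 4 by ring]
  exact le_of_mul_le_mul_right this (by positivity)

theorem sup_facts {φ : E3 → ℝ} (hφ : ContinuousOn φ cball3) :
    (0 ≤ ⨆ x ∈ ball3, |φ x|) ∧ ∀ x ∈ ball3, |φ x| ≤ ⨆ x ∈ ball3, |φ x| := by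
  constructor
  · exact Real.iSup_nonneg fun x => Real.iSup_nonneg fun _ => abs_nonneg _
  · intro x hx
    obtain ⟨R, hR⟩ := isCompact_cball3.exists_bound_of_continuousOn hφ
    have hR0 : 0 ≤ R := (norm_nonneg _).trans (hR x (ball3_subset hx))
    have hb : BddAbove (Set.range fun x => ⨆ (_ : x ∈ ball3), |φ x|) := by
      refine ⟨R, ?_⟩
      rintro _ ⟨y, rfl⟩
      exact Real.iSup_le (fun hy => hR y (ball3_subset hy)) hR0
    have h := le_ciSup hb x
    have e : (⨆ (_ : x ∈ ball3), |φ x|) = |φ x| := ciSup_pos hx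
    simp only [e] at h
    exact h

theorem K_bound {φ : E3 → ℝ} (hφ : ContDiffOn ℝ 2 φ cball3) {q M : ℝ} (hq : 1 ≤ q) (hM : 0 < M) :
    ∫ x in ball3, NN φ x ^ q ≤
      volume.real ball3 * M ^ (2 * q) + (M ^ 2)⁻¹ * ∫ x in ball3, NN φ x ^ (q + 1) := by
  have hpt : ∀ x ∈ ball3, NN φ x ^ q ≤ M ^ (2 * q) + (M ^ 2)⁻¹ * NN φ x ^ (q + 1) := by
    intro x _
    have hN := NN_nonneg φ x
    have e : M ^ (2 * q) = (M ^ 2) ^ q := by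
      rw [← Real.rpow_natCast, ← Real.rpow_mul hM.le]; norm_num
    rcases le_total (NN φ x) (M ^ 2) with h | h
    · have h1 := Real.rpow_le_rpow hN h (by linarith : 0 ≤ q)
      have h2 : 0 ≤ (M ^ 2)⁻¹ * NN φ x ^ (q + 1) :=
        mul_nonneg (by positivity) (Real.rpow_nonneg hN _)
      rw [e]; linarith
    · have h0 : 0 ≤ M ^ (2 * q) := Real.rpow_nonneg hM.le _
      have h1 : NN φ x ^ q ≤ (M ^ 2)⁻¹ * NN φ x ^ (q + 1) := by
        rw [Real.rpow_add' hN (by linarith), Real.rpow_one, inv_mul_eq_div, le_div_iff₀ (by positivity)]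
        exact mul_le_mul_of_nonneg_left h (Real.rpow_nonneg hN _)
      linarith
  have hi1 : IntegrableOn (fun _ : E3 => M ^ (2 * q)) ball3 := integrableOn_cont continuousOn_const
  have hi2 : IntegrableOn (fun x => (M ^ 2)⁻¹ * NN φ x ^ (q + 1)) ball3 :=
    integrableOn_cont (continuousOn_const.mul (NN_rpow_cont hφ (by linarith)))
  have h := setIntegral_mono_on (integrableOn_cont (NN_rpow_cont hφ (by linarith))) (hi1.add hi2)
    measurableSet_ball3 hpt
  refine h.trans (le_of_eq ?_)
  simp only [Pi.add_apply]
  rw [integral_add hi1 hi2, integral_const_mul, setIntegral_const, smul_eq_mul]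

theorem final_alg {A J L M I D q lam θ : ℝ} (hq : 1 ≤ q) (hM : 0 < M) (hI : 0 ≤ I) (hD : 1 ≤ D)
    (hA0 : 0 ≤ A) (hJ0 : 0 ≤ J) (hL0 : 0 ≤ L) (hθ0 : 0 ≤ θ) (hθ1 : θ < 1) (hlam : 1 ≤ lam)
    (hθ : lam = 2 * q + 2 + θ * (4 * q - 2))
    (hA : A ≤ D * M ^ 2 * max I (M ^ (2 * q))) (hJ : J ≤ D * max I (M ^ (2 * q)) ^ 3)
    (hL : L ≤ A ^ (1 - θ) * J ^ θ) :
    L ^ (1 / lam) ≤ D * I ^ ((lam - 3) / ((2 * q - 1) * lam)) *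
      M ^ ((6 * q - lam) / ((2 * q - 1) * lam)) + D * M := by
  set X := max I (M ^ (2 * q)) with hX
  have hX0 : 0 < X := lt_max_of_lt_right (Real.rpow_pos_of_pos hM _)
  have hD0 : 0 < D := by linarith
  have h2q : 0 < 2 * q - 1 := by linarith
  have h1 : L ≤ D * (M ^ (2 * (1 - θ)) * X ^ (1 + 2 * θ)) := by
    refine hL.trans ?_
    calc A ^ (1 - θ) * J ^ θ ≤ (D * M ^ 2 * X) ^ (1 - θ) * (D * X ^ 3) ^ θ := by
          have a1 := Real.rpow_le_rpow hA0 hA (by linarith : 0 ≤ 1 - θ)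
          have a2 := Real.rpow_le_rpow hJ0 hJ hθ0
          exact mul_le_mul a1 a2 (Real.rpow_nonneg hJ0 _) (by positivity)
      _ = D * (M ^ (2 * (1 - θ)) * X ^ (1 + 2 * θ)) := by
          rw [Real.mul_rpow (by positivity) hX0.le, Real.mul_rpow hD0.le (by positivity),
            Real.mul_rpow hD0.le (by positivity)]
          have e1 : (M ^ 2) ^ (1 - θ) = M ^ (2 * (1 - θ)) := by
            rw [← Real.rpow_natCast, ← Real.rpow_mul hM.le]; norm_num
          have e2 : (X ^ 3) ^ θ = X ^ (3 * θ) := by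
            rw [← Real.rpow_natCast, ← Real.rpow_mul hX0.le]; norm_num
          have e3 : X ^ (1 + 2 * θ) = X ^ (1 - θ) * X ^ (3 * θ) := by
            rw [← Real.rpow_add hX0]; congr 1; ring
          have e4 : D ^ (1 - θ) * D ^ θ = D := by
            rw [← Real.rpow_add hD0]; simp
          rw [e1, e2, e3]
          calc _ = (D ^ (1 - θ) * D ^ θ) * (M ^ (2 * (1 - θ)) * (X ^ (1 - θ) * X ^ (3 * θ))) := by ring
            _ = _ := by rw [e4]
  have hlam0 : 0 < lam := by linarith
  have h2 := Real.rpow_le_rpow hL0 h1 (by positivity : 0 ≤ 1 / lam)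
  have hDl : D ^ (1 / lam) ≤ D := by
    calc D ^ (1 / lam) ≤ D ^ (1 : ℝ) := Real.rpow_le_rpow_of_exponent_le hD (by
          rw [div_le_one hlam0]; exact hlam)
      _ = D := Real.rpow_one D
  rw [Real.mul_rpow hD0.le (by positivity), Real.mul_rpow (by positivity) (by positivity),
    ← Real.rpow_mul hM.le, ← Real.rpow_mul hX0.le] at h2
  have x1 : 2 * (1 - θ) * (1 / lam) = (6 * q - lam) / ((2 * q - 1) * lam) := by
    field_simp; rw [hθ]; ring
  have x2 : (1 + 2 * θ) * (1 / lam) = (lam - 3) / ((2 * q - 1) * lam) := by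
    field_simp; rw [hθ]; ring
  rcases le_total (M ^ (2 * q)) I with h | h
  · have hXI : X = I := max_eq_left h
    rw [x1, x2, hXI] at h2
    have p1 : 0 ≤ M ^ ((6 * q - lam) / ((2 * q - 1) * lam)) := Real.rpow_nonneg hM.le _
    have p2 : 0 ≤ I ^ ((lam - 3) / ((2 * q - 1) * lam)) := Real.rpow_nonneg hI _
    have h3 := mul_le_mul_of_nonneg_right hDl (mul_nonneg p1 p2)
    have : 0 ≤ D * M := by positivity
    linarith [mul_assoc D (I ^ ((lam - 3) / ((2 * q - 1) * lam))) (M ^ ((6 * q - lam) / ((2 * q - 1) * lam))),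
      mul_comm (I ^ ((lam - 3) / ((2 * q - 1) * lam))) (M ^ ((6 * q - lam) / ((2 * q - 1) * lam)))]
  · have hXI : X = M ^ (2 * q) := max_eq_right h
    rw [hXI, ← Real.rpow_mul hM.le, ← Real.rpow_add hM,
      show 2 * (1 - θ) * (1 / lam) + 2 * q * ((1 + 2 * θ) * (1 / lam)) = 1 by
        field_simp; rw [hθ]; ring, Real.rpow_one] at h2
    have h3 := mul_le_mul_of_nonneg_right hDl hM.le
    have p1 : 0 ≤ M ^ ((6 * q - lam) / ((2 * q - 1) * lam)) := Real.rpow_nonneg hM.le _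
    have p2 : 0 ≤ I ^ ((lam - 3) / ((2 * q - 1) * lam)) := Real.rpow_nonneg hI _
    have : 0 ≤ D * I ^ ((lam - 3) / ((2 * q - 1) * lam)) *
      M ^ ((6 * q - lam) / ((2 * q - 1) * lam)) := by positivity
    linarith

/-- Lemma 6 of the paper, specialized to the unit ball `B ⊂ ℝ³`:
for `q ≥ 1` and `λ ∈ [2q+2, 4q+1]` there is `C > 0` such that for every `φ` which is `C²`
on the closed unit ball and satisfies `φ · ∂φ/∂ν = 0` on `∂B`,
`‖∇φ‖_{L^λ(B)} ≤ C ‖|∇φ|^{q-1} D²φ‖_{L²(B)}^{(2λ-6)/((2q-1)λ)} ‖φ‖_{L^∞(B)}^{(6q-λ)/((2q-1)λ)}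
  + C ‖φ‖_{L^∞(B)}`. -/
theorem unit_ball_gradient_interpolation (q lam : ℝ) (hq : 1 ≤ q)
    (hlam1 : 2 * q + 2 ≤ lam) (hlam2 : lam ≤ 4 * q + 1) :
    ∃ C > 0, ∀ φ : EuclideanSpace ℝ (Fin 3) → ℝ,
      ContDiffOn ℝ 2 φ cball3 →
      (∀ x : EuclideanSpace ℝ (Fin 3), ‖x‖ = 1 → φ x * grad3 φ x x = 0) →
      (∫ x in ball3, ‖grad3 φ x‖ ^ lam) ^ (1 / lam) ≤
        C * (∫ x in ball3, ‖grad3 φ x‖ ^ (2 * q - 2) * hessFrobSq φ x) ^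
              ((lam - 3) / ((2 * q - 1) * lam)) *
            (⨆ x ∈ ball3, |φ x|) ^ ((6 * q - lam) / ((2 * q - 1) * lam))
          + C * (⨆ x ∈ ball3, |φ x|) := by
  obtain ⟨C0, hC0, hJb⟩ := J_bound1
  set c := 2 + 2 * q with hc
  set V := (volume : Measure (EuclideanSpace ℝ (Fin 3))).real ball3 with hV
  have hV0 : 0 ≤ V := measureReal_nonneg
  set c3 := 1 + c ^ 2 + V with hc3
  set CJ := C0 ^ 4 * (4 * (1 + q)) ^ 6 * c3 ^ 3 with hCJ
  have hc30 : 0 ≤ c3 := by positivity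
  have hCJ0 : 0 ≤ CJ := by positivity
  set D := 1 + c ^ 2 + 8 * CJ with hD
  have hD1 : 1 ≤ D := by
    have : 0 ≤ c ^ 2 := sq_nonneg _
    linarith
  refine ⟨D, by linarith, fun φ hφ hbd => ?_⟩
  obtain ⟨hM0, hM⟩ := sup_facts hφ.continuousOn
  set M := ⨆ x ∈ ball3, |φ x| with hMdef
  have eL : ∀ x, ‖grad3 φ x‖ ^ lam = NN φ x ^ (lam / 2) := fun x => norm_grad_rpow φ x lam
  have eI : ∀ x, ‖grad3 φ x‖ ^ (2 * q - 2) = NN φ x ^ (q - 1) := fun x => by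
    rw [norm_grad_rpow]; congr 1; ring
  simp only [eL, eI]
  have hr : ∀ (a : ℝ) (x : E3), 0 ≤ NN φ x ^ a := fun a x => Real.rpow_nonneg (NN_nonneg φ x) _
  have hA := int_ineq1 hφ hbd hq hM
  have hJ1 := hJb φ q hφ hq
  have hT := T_bound hφ hq
  have hT0 : 0 ≤ ∫ x in ball3, HH φ q x := integral_nonneg (HH_nonneg φ hq)
  set θ := (lam - 2 * q - 2) / (4 * q - 2) with hθdef
  have h4q : 0 < 4 * q - 2 := by linarith
  have hθ0 : 0 ≤ θ := div_nonneg (by linarith) h4q.le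
  have hθ1 : θ < 1 := by rw [hθdef, div_lt_one h4q]; linarith
  have hθ : lam = 2 * q + 2 + θ * (4 * q - 2) := by
    rw [hθdef, div_mul_cancel₀ _ h4q.ne']; ring
  have hL := holder_real (NN_rpow_cont hφ (show 0 ≤ q + 1 by linarith))
    (NN_rpow_cont hφ (show 0 ≤ 3 * q by linarith)) (hr _) (hr _)
    (by linarith : 0 ≤ 1 - θ) hθ0 (by ring)
  have e1 : ∀ x, (NN φ x ^ (q + 1)) ^ (1 - θ) * (NN φ x ^ (3 * q)) ^ θ = NN φ x ^ (lam / 2) := by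
    intro x
    have e : (q + 1) * (1 - θ) + 3 * q * θ = lam / 2 := by rw [hθ]; ring
    rw [← Real.rpow_mul (NN_nonneg φ x), ← Real.rpow_mul (NN_nonneg φ x),
      ← Real.rpow_add' (NN_nonneg φ x) (by rw [e]; apply ne_of_gt; linarith), e]
  simp only [e1] at hL
  have hA0 : 0 ≤ ∫ x in ball3, NN φ x ^ (q + 1) := integral_nonneg (hr _)
  have hJ0 : 0 ≤ ∫ x in ball3, NN φ x ^ (3 * q) := integral_nonneg (hr _)
  have hL0 : 0 ≤ ∫ x in ball3, NN φ x ^ (lam / 2) := integral_nonneg (hr _)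
  have hK0 : 0 ≤ ∫ x in ball3, NN φ x ^ q := integral_nonneg (hr _)
  have hI0 : 0 ≤ ∫ x in ball3, NN φ x ^ (q - 1) * hessFrobSq φ x :=
    integral_nonneg fun x => mul_nonneg (hr _ x) (frob_nonneg φ x)
  rcases hM0.eq_or_lt with hMz | hMp
  · rw [← hMz] at hA ⊢
    have hAz : ∫ x in ball3, NN φ x ^ (q + 1) = 0 := le_antisymm (by simpa using hA) hA0
    rw [hAz, Real.zero_rpow (by linarith), zero_mul] at hL
    rw [le_antisymm hL hL0, Real.zero_rpow (by apply ne_of_gt; apply one_div_pos.2; linarith)]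
    have p1 : (0 : ℝ) ≤ 0 ^ ((6 * q - lam) / ((2 * q - 1) * lam)) := Real.rpow_nonneg le_rfl _
    have p2 := Real.rpow_nonneg hI0 ((lam - 3) / ((2 * q - 1) * lam))
    have p3 : 0 ≤ D := by linarith
    positivity
  have hK := K_bound hφ hq hMp
  set A := ∫ x in ball3, NN φ x ^ (q + 1)
  set J := ∫ x in ball3, NN φ x ^ (3 * q)
  set L := ∫ x in ball3, NN φ x ^ (lam / 2)
  set K := ∫ x in ball3, NN φ x ^ q
  set I := ∫ x in ball3, NN φ x ^ (q - 1) * hessFrobSq φ x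
  set X := max I (M ^ (2 * q)) with hX
  have hXI : I ≤ X := le_max_left _ _
  have hXM : M ^ (2 * q) ≤ X := le_max_right _ _
  have hX0 : 0 ≤ X := hI0.trans hXI
  have hK2 : K ≤ V * X + c ^ 2 * X := by
    have h1 : (M ^ 2)⁻¹ * A ≤ (M ^ 2)⁻¹ * (c ^ 2 * M ^ 2 * I) :=
      mul_le_mul_of_nonneg_left hA (by positivity)
    have h2 : (M ^ 2)⁻¹ * (c ^ 2 * M ^ 2 * I) = c ^ 2 * I := by
      field_simp
    have h3 : V * M ^ (2 * q) ≤ V * X := mul_le_mul_of_nonneg_left hXM hV0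
    have h4 : c ^ 2 * I ≤ c ^ 2 * X := mul_le_mul_of_nonneg_left hXI (sq_nonneg _)
    linarith
  have hS : I + K ≤ c3 * X := by rw [hc3]; linarith
  have hJ2 := J_alg hJ0 (add_nonneg hI0 hK0) hT0 hC0 (by linarith : 0 ≤ 4 * (1 + q)) hJ1 hT
  have hJ3 : J ≤ CJ * X ^ 3 := by
    refine hJ2.trans ?_
    calc _ ≤ C0 ^ 4 * (4 * (1 + q)) ^ 6 * (c3 * X) ^ 3 := by gcongr
      _ = _ := by rw [hCJ]; ring
  refine final_alg hq hMp hI0 hD1 hA0 hJ0 hL0 hθ0 hθ1 (by linarith) hθ ?_ ?_ hL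
  · refine hA.trans ?_
    have : c ^ 2 ≤ D := by linarith
    gcongr
  · refine hJ3.trans ?_
    have : CJ ≤ D := by linarith [sq_nonneg c]
    gcongr
end

section
/- Let T ∈ (0, ∞], let a > 0, b > 0 and K ≥ 0, let y : [0, T) → ℝ be continuous on [0, T) and differentiable on (0, T), and let h : (0, T) → ℝ be nonnegative. Assume that y′(t) + a·h(t) ≤ K and y(t) ≤ b·h(t) + b for all t ∈ (0, T). Then y(t) ≤ max{ y(0), (K·b)/a + b } for all t ∈ [0, T). -/
open Set ENNReal

/-- Absorption argument from the proof of Lemma 12 of the paper: if `y` is continuous on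
`[0,T)`, differentiable on `(0,T)` (`T ∈ (0,∞]`), `h ≥ 0` on `(0,T)`, and
`y′(t) + a·h(t) ≤ K` together with `y(t) ≤ b·h(t) + b` hold on `(0,T)` with `a, b > 0`,
`K ≥ 0`, then `y(t) ≤ max {y(0), K·b/a + b}` on `[0,T)`. -/
theorem ode_absorption_bound (T : ℝ≥0∞) (hT : 0 < T) (a b K : ℝ)
    (ha : 0 < a) (hb : 0 < b) (hK : 0 ≤ K) (y h : ℝ → ℝ)
    (hcont : ContinuousOn y {t : ℝ | 0 ≤ t ∧ ENNReal.ofReal t < T})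
    (hdiff : ∀ t : ℝ, 0 < t → ENNReal.ofReal t < T → DifferentiableAt ℝ y t)
    (hh : ∀ t : ℝ, 0 < t → ENNReal.ofReal t < T → 0 ≤ h t)
    (hineq : ∀ t : ℝ, 0 < t → ENNReal.ofReal t < T → deriv y t + a * h t ≤ K)
    (hdom : ∀ t : ℝ, 0 < t → ENNReal.ofReal t < T → y t ≤ b * h t + b) :
    ∀ t : ℝ, 0 ≤ t → ENNReal.ofReal t < T → y t ≤ max (y 0) (K * b / a + b) := by
  intro t ht htT
  set M := max (y 0) (K * b / a + b) with hM
  have hM0 : y 0 ≤ M := le_max_left _ _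
  have hM1 : K * b / a + b ≤ M := le_max_right _ _
  have hlt : ∀ x : ℝ, x ≤ t → ENNReal.ofReal x < T := fun x hx =>
    lt_of_le_of_lt (ENNReal.ofReal_le_ofReal hx) htT
  have hE : ∀ x : ℝ, HasDerivAt (fun x : ℝ => Real.exp (a / b * x))
      (Real.exp (a / b * x) * (a / b)) x := by
    intro x
    have := ((hasDerivAt_id x).const_mul (a / b)).exp
    simpa using this
  have hanti : AntitoneOn (fun x => (y x - M) * Real.exp (a / b * x)) (Icc 0 t) := by
    have hD : ∀ x ∈ interior (Icc 0 t), HasDerivAt (fun x => (y x - M) * Real.exp (a / b * x))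
        (deriv y x * Real.exp (a / b * x)
          + (y x - M) * (Real.exp (a / b * x) * (a / b))) x := by
      intro x hx
      rw [interior_Icc] at hx
      exact ((hdiff x hx.1 (hlt x hx.2.le)).hasDerivAt.sub_const M).mul (hE x)
    apply antitoneOn_of_deriv_nonpos (convex_Icc 0 t)
    · refine ContinuousOn.mul (ContinuousOn.sub (hcont.mono ?_) continuousOn_const) ?_
      · intro x hx
        exact ⟨hx.1, hlt x hx.2⟩
      · fun_prop
    · intro x hx
      exact (hD x hx).differentiableAt.differentiableWithinAt
    · intro x hx
      rw [(hD x hx).deriv]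
      rw [interior_Icc] at hx
      have h1 := hineq x hx.1 (hlt x hx.2.le)
      have h2 := hdom x hx.1 (hlt x hx.2.le)
      have hc : 0 < a / b := div_pos ha hb
      have h3 : a / b * (y x - M) ≤ a / b * (b * h x - K * b / a) :=
        mul_le_mul_of_nonneg_left (by linarith) hc.le
      have h4 : a / b * (b * h x - K * b / a) = a * h x - K := by
        field_simp
      have h5 : deriv y x + a / b * (y x - M) ≤ 0 := by linarith
      have := mul_nonpos_of_nonpos_of_nonneg h5 (Real.exp_pos (a / b * x)).le
      linarith
  have h6 := hanti (left_mem_Icc.2 ht) (right_mem_Icc.2 ht) ht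
  simp only [mul_zero, Real.exp_zero, mul_one] at h6
  by_contra hcon
  have := mul_pos (sub_pos.2 (not_le.1 hcon)) (Real.exp_pos (a / b * t))
  linarith
end
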